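/- Let (R_μ)_{μ ∈ I} be a finite family of Hermitian n×n complex matrices with associated quantities α₁, α₂, β₁, …, β₅. Then max_{u ∈ {1,…,5}} |β_u| = max_{i,j ∈ {1,2}} |α_i · α_j| holds if and only if there exist a Hermitian n×n matrix A satisfying Tr(A²) ≥ (Tr A)² and real numbers (r_μ)_{μ ∈ I} such that R_μ = r_μ · A for every μ ∈ I. -/

import Mathlib

open Matrix Finset

/-- Real part of the trace of a complex matrix (the traces in question are real
for Hermitian matrices). -/
noncomputable def rtr {α : Type} [Fintype α] (M : Matrix α α ℂ) : ℝ :=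
  (Matrix.trace M).re

/-- α₁ = ∑_μ (Tr R_μ)². -/
noncomputable def alpha1 {α I : Type} [Fintype α] [Fintype I]
    (R : I → Matrix α α ℂ) : ℝ := ∑ μ, (rtr (R μ)) ^ 2

/-- α₂ = ∑_μ Tr(R_μ²). -/
noncomputable def alpha2 {α I : Type} [Fintype α] [Fintype I]
    (R : I → Matrix α α ℂ) : ℝ := ∑ μ, rtr (R μ * R μ)

/-- β₁ = ∑_{μ,ν} (Tr(R_μ R_ν))². -/
noncomputable def beta1 {α I : Type} [Fintype α] [Fintype I]
    (R : I → Matrix α α ℂ) : ℝ := ∑ μ, ∑ ν, (rtr (R μ * R ν)) ^ 2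

/-- β₂ = ∑_{μ,ν} Tr(R_μ R_ν)·Tr(R_μ)·Tr(R_ν). -/
noncomputable def beta2 {α I : Type} [Fintype α] [Fintype I]
    (R : I → Matrix α α ℂ) : ℝ := ∑ μ, ∑ ν, rtr (R μ * R ν) * rtr (R μ) * rtr (R ν)

/-- β₃ = ∑_{μ,ν} Tr(R_μ R_ν²)·Tr(R_μ). -/
noncomputable def beta3 {α I : Type} [Fintype α] [Fintype I]
    (R : I → Matrix α α ℂ) : ℝ := ∑ μ, ∑ ν, rtr (R μ * (R ν * R ν)) * rtr (R μ)

/-- β₄ = ∑_{μ,ν} Tr(R_μ² R_ν²). -/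
noncomputable def beta4 {α I : Type} [Fintype α] [Fintype I]
    (R : I → Matrix α α ℂ) : ℝ := ∑ μ, ∑ ν, rtr (R μ * R μ * (R ν * R ν))

/-- β₅ = ∑_{μ,ν} Tr(R_μ R_ν R_μ R_ν). -/
noncomputable def beta5 {α I : Type} [Fintype α] [Fintype I]
    (R : I → Matrix α α ℂ) : ℝ := ∑ μ, ∑ ν, rtr (R μ * R ν * R μ * R ν)

/-- max_{i,j ∈ {1,2}} |α_i α_j|. -/
noncomputable def maxAlpha {α I : Type} [Fintype α] [Fintype I]
    (R : I → Matrix α α ℂ) : ℝ :=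
  max (max |alpha1 R * alpha1 R| |alpha1 R * alpha2 R|)
      (max |alpha2 R * alpha1 R| |alpha2 R * alpha2 R|)

/-- max_{u ∈ {1,…,5}} |β_u|. -/
noncomputable def maxBeta {α I : Type} [Fintype α] [Fintype I]
    (R : I → Matrix α α ℂ) : ℝ :=
  max |beta1 R| (max |beta2 R| (max |beta3 R| (max |beta4 R| |beta5 R|)))

/-! ### Auxiliary facts -/

namespace MaxBeta

variable {n : ℕ} {I : Type} [Fintype I]

lemma rtr_add (X Y : Matrix (Fin n) (Fin n) ℂ) : rtr (X + Y) = rtr X + rtr Y := by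
  simp [rtr]

lemma rtr_sub (X Y : Matrix (Fin n) (Fin n) ℂ) : rtr (X - Y) = rtr X - rtr Y := by
  simp [rtr]

lemma rtr_smul (c : ℝ) (X : Matrix (Fin n) (Fin n) ℂ) : rtr ((c : ℂ) • X) = c * rtr X := by
  simp [rtr]

lemma rtr_sum (f : I → Matrix (Fin n) (Fin n) ℂ) : rtr (∑ μ, f μ) = ∑ μ, rtr (f μ) := by
  simp [rtr, Matrix.trace_sum]

lemma rtr_comm (X Y : Matrix (Fin n) (Fin n) ℂ) : rtr (X * Y) = rtr (Y * X) := by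
  simp [rtr, Matrix.trace_mul_comm X Y]

lemma rtr_conjTranspose_mul (X : Matrix (Fin n) (Fin n) ℂ) :
    rtr (Xᴴ * X) = ∑ j, ∑ i, ‖X i j‖ ^ 2 := by
  simp only [rtr, Matrix.trace, Matrix.diag, Matrix.mul_apply, Matrix.conjTranspose_apply,
    Complex.re_sum]
  refine Finset.sum_congr rfl fun j _ => Finset.sum_congr rfl fun i _ => ?_
  rw [← Complex.normSq_eq_norm_sq, Complex.normSq_apply]
  simp

lemma rtr_sq (X : Matrix (Fin n) (Fin n) ℂ) (hX : X.IsHermitian) :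
    rtr (X * X) = ∑ j, ∑ i, ‖X i j‖ ^ 2 := by
  rw [← rtr_conjTranspose_mul, hX.eq]

lemma rtr_sq_nonneg (X : Matrix (Fin n) (Fin n) ℂ) (hX : X.IsHermitian) :
    0 ≤ rtr (X * X) := by
  rw [rtr_sq X hX]; positivity

lemma eq_zero_of_rtr_sq (X : Matrix (Fin n) (Fin n) ℂ) (hX : X.IsHermitian)
    (h : rtr (X * X) = 0) : X = 0 := by
  rw [rtr_sq X hX, Finset.sum_eq_zero_iff_of_nonneg (fun _ _ => by positivity)] at h
  ext i j
  have h1 := h j (Finset.mem_univ _)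
  rw [Finset.sum_eq_zero_iff_of_nonneg (fun _ _ => by positivity)] at h1
  have h2 := h1 i (Finset.mem_univ _)
  simpa using h2

lemma herm_smul (c : ℝ) {X : Matrix (Fin n) (Fin n) ℂ} (hX : X.IsHermitian) :
    ((c : ℂ) • X).IsHermitian := by
  rw [Matrix.IsHermitian, Matrix.conjTranspose_smul, hX.eq]
  simp

lemma herm_sum {f : I → Matrix (Fin n) (Fin n) ℂ} (hf : ∀ μ, (f μ).IsHermitian) :
    (∑ μ, f μ).IsHermitian := by
  rw [Matrix.IsHermitian, Matrix.conjTranspose_sum]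
  exact Finset.sum_congr rfl fun μ _ => (hf μ).eq

lemma herm_sq {X : Matrix (Fin n) (Fin n) ℂ} (hX : X.IsHermitian) : (X * X).IsHermitian := by
  rw [Matrix.IsHermitian, Matrix.conjTranspose_mul, hX.eq]

lemma comb_sq (a b : ℝ) (X Y : Matrix (Fin n) (Fin n) ℂ) :
    rtr (((a : ℂ) • X - (b : ℂ) • Y) * ((a : ℂ) • X - (b : ℂ) • Y)) =
      a ^ 2 * rtr (X * X) - 2 * a * b * rtr (X * Y) + b ^ 2 * rtr (Y * Y) := by
  simp only [sub_mul, mul_sub, rtr_sub, smul_mul_assoc, mul_smul_comm, rtr_smul,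
    rtr_comm Y X]
  ring

lemma cs (X Y : Matrix (Fin n) (Fin n) ℂ) (hX : X.IsHermitian) (hY : Y.IsHermitian) :
    rtr (X * Y) ^ 2 ≤ rtr (X * X) * rtr (Y * Y) := by
  have h := rtr_sq_nonneg _ ((herm_smul (rtr (Y * Y)) hX).sub (herm_smul (rtr (X * Y)) hY))
  rw [comb_sq] at h
  rcases (rtr_sq_nonneg Y hY).eq_or_lt with h0 | h0
  · have := eq_zero_of_rtr_sq Y hY h0.symm
    subst this
    simp [rtr]
  · by_contra hc
    push Not at hc
    nlinarith [mul_pos h0 (sub_pos.2 hc)]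

lemma cs_eq (X Y : Matrix (Fin n) (Fin n) ℂ) (hX : X.IsHermitian) (hY : Y.IsHermitian)
    (h : rtr (X * Y) ^ 2 = rtr (X * X) * rtr (Y * Y)) (h0 : rtr (Y * Y) ≠ 0) :
    X = ((rtr (X * Y) / rtr (Y * Y) : ℝ) : ℂ) • Y := by
  have h1 := comb_sq 1 (rtr (X * Y) / rtr (Y * Y)) X Y
  have h2 : (1 : ℝ) ^ 2 * rtr (X * X) - 2 * 1 * (rtr (X * Y) / rtr (Y * Y)) * rtr (X * Y) +
      (rtr (X * Y) / rtr (Y * Y)) ^ 2 * rtr (Y * Y) = 0 := by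
    field_simp
    linear_combination -h
  rw [h2] at h1
  have h3 := eq_zero_of_rtr_sq _ ((herm_smul 1 hX).sub (herm_smul _ hY)) h1
  rw [sub_eq_zero] at h3
  simpa using h3

/-- A column of a matrix as a Euclidean vector. -/
noncomputable def col (X : Matrix (Fin n) (Fin n) ℂ) (i : Fin n) : EuclideanSpace ℂ (Fin n) :=
  WithLp.toLp 2 fun k => X k i

lemma rtr_sq_col (X : Matrix (Fin n) (Fin n) ℂ) (hX : X.IsHermitian) :
    rtr (X * X) = ∑ i, ‖col X i‖ ^ 2 := by
  rw [rtr_sq X hX]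
  simp [EuclideanSpace.norm_sq_eq, col]

lemma mul_eq_inner (X Y : Matrix (Fin n) (Fin n) ℂ) (hX : X.IsHermitian) (i j : Fin n) :
    (X * Y) i j = inner ℂ (col X i) (col Y j) := by
  simp only [PiLp.inner_apply, col, Matrix.mul_apply]
  refine Finset.sum_congr rfl fun k _ => ?_
  rw [← hX.apply i k]
  simp [mul_comm]

lemma rtr_quad (X Y : Matrix (Fin n) (Fin n) ℂ) (hX : X.IsHermitian) (hY : Y.IsHermitian) :
    rtr (X * X * (Y * Y)) = ∑ j, ∑ i, ‖(X * Y) i j‖ ^ 2 := by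
  rw [← rtr_conjTranspose_mul, Matrix.conjTranspose_mul, hX.eq, hY.eq]
  rw [← mul_assoc, rtr_comm, ← mul_assoc, ← mul_assoc, ← mul_assoc]

lemma quad_term_le (X Y : Matrix (Fin n) (Fin n) ℂ) (hX : X.IsHermitian) (i j : Fin n) :
    ‖(X * Y) i j‖ ^ 2 ≤ ‖col X i‖ ^ 2 * ‖col Y j‖ ^ 2 := by
  rw [mul_eq_inner X Y hX, ← mul_pow]
  exact pow_le_pow_left₀ (norm_nonneg _) (norm_inner_le_norm _ _) 2

lemma quad_prod (X Y : Matrix (Fin n) (Fin n) ℂ) (hX : X.IsHermitian) (hY : Y.IsHermitian) :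
    rtr (X * X) * rtr (Y * Y) = ∑ j, ∑ i, ‖col X i‖ ^ 2 * ‖col Y j‖ ^ 2 := by
  rw [rtr_sq_col X hX, rtr_sq_col Y hY, Finset.sum_mul_sum, Finset.sum_comm]

lemma quad_le (X Y : Matrix (Fin n) (Fin n) ℂ) (hX : X.IsHermitian) (hY : Y.IsHermitian) :
    rtr (X * X * (Y * Y)) ≤ rtr (X * X) * rtr (Y * Y) := by
  rw [rtr_quad X Y hX hY, quad_prod X Y hX hY]
  exact Finset.sum_le_sum fun j _ => Finset.sum_le_sum fun i _ => quad_term_le X Y hX i j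

lemma quad_eq (X Y : Matrix (Fin n) (Fin n) ℂ) (hX : X.IsHermitian) (hY : Y.IsHermitian)
    (h : rtr (X * X * (Y * Y)) = rtr (X * X) * rtr (Y * Y)) (i j : Fin n)
    (h0 : col X i ≠ 0) : ∃ c : ℂ, col Y j = c • col X i := by
  rw [rtr_quad X Y hX hY, quad_prod X Y hX hY,
    Finset.sum_eq_sum_iff_of_le
      (fun j _ => Finset.sum_le_sum fun i _ => quad_term_le X Y hX i j)] at h
  have h1 := h j (Finset.mem_univ _)
  rw [Finset.sum_eq_sum_iff_of_le (fun i _ => quad_term_le X Y hX i j)] at h1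
  have h2 := h1 i (Finset.mem_univ _)
  by_cases h3 : col Y j = 0
  · exact ⟨0, by simp [h3]⟩
  rw [mul_eq_inner X Y hX, ← mul_pow, pow_left_inj₀ (by positivity) (by positivity) two_ne_zero,
    norm_inner_eq_norm_iff h0 h3] at h2
  obtain ⟨r, _, hr⟩ := h2
  exact ⟨r, hr⟩

lemma rank_one (X : Matrix (Fin n) (Fin n) ℂ) (hX : X.IsHermitian) (v : Fin n → ℂ) (i0 : Fin n)
    (hv : v i0 ≠ 0) (h : ∀ j, ∃ w : ℂ, ∀ i, X i j = w * v i) :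
    ∃ r : ℝ, X = (r : ℂ) • Matrix.vecMulVec v (star v) := by
  choose w hw using h
  have hs : star (v i0) ≠ 0 := star_ne_zero.2 hv
  have h1 : ∀ j, w j * v i0 = star (w i0) * star (v j) := by
    intro j
    rw [← hw, ← hX.apply i0 j, hw, star_mul']
  have h2 : ((X i0 i0).re : ℂ) = X i0 i0 := by
    rw [← Complex.conj_eq_iff_re]
    exact hX.apply i0 i0
  refine ⟨(X i0 i0).re / Complex.normSq (v i0), ?_⟩
  ext i j
  simp only [Matrix.smul_apply, Matrix.vecMulVec_apply, Pi.star_apply, smul_eq_mul]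
  push_cast
  rw [h2, hw, hw, Complex.normSq_eq_conj_mul_self]
  have hs' : (starRingEnd ℂ) (v i0) ≠ 0 := hs
  have e1 := h1 j
  have e2 := h1 i0
  change _ = _ * (starRingEnd ℂ) (v i0) at e2
  field_simp
  apply mul_right_cancel₀ hv
  linear_combination (v i * (starRingEnd ℂ) (v i0)) * e1 - (v i * star (v j)) * e2

lemma beta5_term (X Y : Matrix (Fin n) (Fin n) ℂ) (hX : X.IsHermitian) (hY : Y.IsHermitian) :
    |rtr (X * Y * X * Y)| ≤ rtr (X * X * (Y * Y)) := by
  have e0 : X * Y * X * Y = (X * Y) * (X * Y) := by simp only [mul_assoc]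
  have e1 := rtr_quad X Y hX hY
  have e2 : rtr (X * X * (Y * Y)) = ∑ j, ∑ i, ‖(X * Y) j i‖ ^ 2 := by rw [e1, Finset.sum_comm]
  have e3 : rtr (X * X * (Y * Y)) =
      ∑ j, ∑ i, (‖(X * Y) i j‖ ^ 2 + ‖(X * Y) j i‖ ^ 2) / 2 := by
    simp only [← Finset.sum_div, Finset.sum_add_distrib]
    linarith
  rw [e3, e0]
  generalize X * Y = Z
  simp only [rtr, Matrix.trace, Matrix.diag, Matrix.mul_apply, Complex.re_sum]
  refine (Finset.abs_sum_le_sum_abs _ _).trans (Finset.sum_le_sum fun j _ => ?_)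
  refine (Finset.abs_sum_le_sum_abs _ _).trans (Finset.sum_le_sum fun i _ => ?_)
  refine (Complex.abs_re_le_norm _).trans ?_
  rw [norm_mul]
  nlinarith [sq_nonneg (‖Z i j‖ - ‖Z j i‖)]

section family

variable (R : I → Matrix (Fin n) (Fin n) ℂ)

/-- The matrix `∑ (Tr R_μ) R_μ`. -/
noncomputable def T : Matrix (Fin n) (Fin n) ℂ := ∑ μ, (rtr (R μ) : ℂ) • R μ

/-- The matrix `∑ R_μ²`. -/
noncomputable def S : Matrix (Fin n) (Fin n) ℂ := ∑ μ, R μ * R μ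

lemma beta2_eq : beta2 R = rtr (T R * T R) := by
  simp only [beta2, T, Finset.sum_mul_sum, rtr_sum, smul_mul_assoc, mul_smul_comm, rtr_smul]
  exact Finset.sum_congr rfl fun _ _ => Finset.sum_congr rfl fun _ _ => by ring

lemma beta3_eq : beta3 R = rtr (T R * S R) := by
  simp only [beta3, T, S, Finset.sum_mul_sum, rtr_sum, smul_mul_assoc, rtr_smul]
  exact Finset.sum_congr rfl fun _ _ => Finset.sum_congr rfl fun _ _ => by ring

lemma beta4_eq : beta4 R = rtr (S R * S R) := by
  simp only [beta4, S, Finset.sum_mul_sum, rtr_sum]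

lemma alpha2_sq : alpha2 R ^ 2 = ∑ μ, ∑ ν, rtr (R μ * R μ) * rtr (R ν * R ν) := by
  rw [alpha2, sq, Finset.sum_mul_sum]


end family

variable {R : I → Matrix (Fin n) (Fin n) ℂ}

lemma T_herm (hR : ∀ μ, (R μ).IsHermitian) : (T R).IsHermitian :=
  herm_sum fun μ => herm_smul _ (hR μ)

lemma S_herm (hR : ∀ μ, (R μ).IsHermitian) : (S R).IsHermitian :=
  herm_sum fun μ => herm_sq (hR μ)

lemma alpha1_nonneg : 0 ≤ alpha1 R := Finset.sum_nonneg fun _ _ => sq_nonneg _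

lemma alpha2_nonneg (hR : ∀ μ, (R μ).IsHermitian) : 0 ≤ alpha2 R :=
  Finset.sum_nonneg fun μ _ => rtr_sq_nonneg _ (hR μ)

lemma beta1_nonneg : 0 ≤ beta1 R :=
  Finset.sum_nonneg fun _ _ => Finset.sum_nonneg fun _ _ => sq_nonneg _

lemma beta1_le (hR : ∀ μ, (R μ).IsHermitian) : beta1 R ≤ alpha2 R ^ 2 := by
  rw [alpha2_sq]
  exact Finset.sum_le_sum fun μ _ => Finset.sum_le_sum fun ν _ => cs _ _ (hR μ) (hR ν)

lemma beta2_nonneg (hR : ∀ μ, (R μ).IsHermitian) : 0 ≤ beta2 R := by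
  rw [beta2_eq]; exact rtr_sq_nonneg _ (T_herm hR)

lemma beta4_nonneg (hR : ∀ μ, (R μ).IsHermitian) : 0 ≤ beta4 R := by
  rw [beta4_eq]; exact rtr_sq_nonneg _ (S_herm hR)

lemma sum_comb : ∑ μ, rtr (((alpha1 R : ℂ) • R μ - (rtr (R μ) : ℂ) • T R) *
      ((alpha1 R : ℂ) • R μ - (rtr (R μ) : ℂ) • T R)) =
    alpha1 R * (alpha1 R * alpha2 R - beta2 R) := by
  have h : ∑ μ, rtr (R μ) * rtr (R μ * T R) = beta2 R := by
    rw [beta2_eq]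
    conv_rhs => rw [T, Finset.sum_mul, rtr_sum]
    simp only [smul_mul_assoc, rtr_smul]
    rfl
  have h' : ∑ μ, (alpha1 R ^ 2 * rtr (R μ * R μ)
      - (2 * alpha1 R) * (rtr (R μ) * rtr (R μ * T R)) + rtr (R μ) ^ 2 * beta2 R) =
      alpha1 R ^ 2 * alpha2 R - (2 * alpha1 R) * beta2 R + alpha1 R * beta2 R := by
    rw [Finset.sum_add_distrib, Finset.sum_sub_distrib, ← Finset.mul_sum, ← Finset.mul_sum, h,
      ← Finset.sum_mul]
    rfl
  calc _ = ∑ μ, (alpha1 R ^ 2 * rtr (R μ * R μ)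
      - (2 * alpha1 R) * (rtr (R μ) * rtr (R μ * T R)) + rtr (R μ) ^ 2 * beta2 R) := by
        refine Finset.sum_congr rfl fun μ _ => ?_
        rw [comb_sq, ← beta2_eq]; ring
    _ = _ := by rw [h']; ring

lemma comb_herm (hR : ∀ μ, (R μ).IsHermitian) (μ : I) :
    ((alpha1 R : ℂ) • R μ - (rtr (R μ) : ℂ) • T R).IsHermitian :=
  (herm_smul _ (hR μ)).sub (herm_smul _ (T_herm hR))

lemma beta2_le (hR : ∀ μ, (R μ).IsHermitian) : beta2 R ≤ alpha1 R * alpha2 R := by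
  have h : 0 ≤ alpha1 R * (alpha1 R * alpha2 R - beta2 R) := by
    rw [← sum_comb]
    exact Finset.sum_nonneg fun μ _ => rtr_sq_nonneg _ (comb_herm hR μ)
  rcases (alpha1_nonneg (R := R)).eq_or_lt with h0 | h0
  · have h1 : ∀ μ, rtr (R μ) = 0 := by
      intro μ
      have := h0.symm
      rw [alpha1, Finset.sum_eq_zero_iff_of_nonneg (fun _ _ => sq_nonneg _)] at this
      simpa using this μ (Finset.mem_univ _)
    rw [← h0]
    simp [beta2, h1]
  · linarith [nonneg_of_mul_nonneg_right h h0]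

lemma beta4_le (hR : ∀ μ, (R μ).IsHermitian) : beta4 R ≤ alpha2 R ^ 2 := by
  rw [alpha2_sq]
  exact Finset.sum_le_sum fun μ _ => Finset.sum_le_sum fun ν _ => quad_le _ _ (hR μ) (hR ν)

lemma beta3_sq_le (hR : ∀ μ, (R μ).IsHermitian) : beta3 R ^ 2 ≤ beta2 R * beta4 R := by
  rw [beta2_eq, beta3_eq, beta4_eq]
  exact cs _ _ (T_herm hR) (S_herm hR)

lemma beta5_le (hR : ∀ μ, (R μ).IsHermitian) : |beta5 R| ≤ beta4 R := by
  refine (Finset.abs_sum_le_sum_abs _ _).trans (Finset.sum_le_sum fun μ _ => ?_)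
  refine (Finset.abs_sum_le_sum_abs _ _).trans (Finset.sum_le_sum fun ν _ => ?_)
  exact beta5_term _ _ (hR μ) (hR ν)

/-- The family is parallel to a single Hermitian matrix. -/
def Par (R : I → Matrix (Fin n) (Fin n) ℂ) : Prop :=
  ∃ A : Matrix (Fin n) (Fin n) ℂ, A.IsHermitian ∧ ∃ r : I → ℝ, ∀ μ, R μ = (r μ : ℂ) • A

lemma exists_ne (hR : ∀ μ, (R μ).IsHermitian) (h : 0 < alpha2 R) :
    ∃ ν, rtr (R ν * R ν) ≠ 0 := by
  by_contra hc
  push Not at hc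
  simp [alpha2, hc] at h

lemma par_of_beta1 (hR : ∀ μ, (R μ).IsHermitian) (h : 0 < alpha2 R)
    (he : beta1 R = alpha2 R ^ 2) : Par R := by
  obtain ⟨ν, hν⟩ := exists_ne hR h
  rw [alpha2_sq, beta1, Finset.sum_eq_sum_iff_of_le
    (fun μ _ => Finset.sum_le_sum fun ν _ => cs _ _ (hR μ) (hR ν))] at he
  refine ⟨R ν, hR ν, fun μ => rtr (R μ * R ν) / rtr (R ν * R ν), fun μ => ?_⟩
  have h1 := he μ (Finset.mem_univ _)
  rw [Finset.sum_eq_sum_iff_of_le (fun ν _ => cs _ _ (hR μ) (hR ν))] at h1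
  exact cs_eq _ _ (hR μ) (hR ν) (h1 ν (Finset.mem_univ _)) hν

lemma par_of_beta2 (hR : ∀ μ, (R μ).IsHermitian) (h : 0 < alpha1 R)
    (he : beta2 R = alpha1 R * alpha2 R) : Par R := by
  have hs := sum_comb (R := R)
  rw [he, sub_self, mul_zero,
    Finset.sum_eq_zero_iff_of_nonneg (fun μ _ => rtr_sq_nonneg _ (comb_herm hR μ))] at hs
  refine ⟨T R, T_herm hR, fun μ => rtr (R μ) / alpha1 R, fun μ => ?_⟩
  have h1 := eq_zero_of_rtr_sq _ (comb_herm hR μ) (hs μ (Finset.mem_univ _))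
  rw [sub_eq_zero] at h1
  have h2 : (alpha1 R : ℂ) ≠ 0 := by exact_mod_cast h.ne'
  apply smul_right_injective _ h2
  simp only [smul_smul]
  rw [h1]
  congr 1
  push_cast
  field_simp

lemma par_of_beta4 (hR : ∀ μ, (R μ).IsHermitian) (h : 0 < alpha2 R)
    (he : beta4 R = alpha2 R ^ 2) : Par R := by
  obtain ⟨ν, hν⟩ := exists_ne hR h
  have hj : ∃ j i, R ν i j ≠ 0 := by
    by_contra hc
    push Not at hc
    exact hν (by rw [rtr_sq _ (hR ν)]; simp [hc])
  obtain ⟨j0, i0, hv⟩ := hj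
  rw [alpha2_sq, beta4, Finset.sum_eq_sum_iff_of_le
    (fun μ _ => Finset.sum_le_sum fun ν _ => quad_le _ _ (hR μ) (hR ν))] at he
  have h1 := he ν (Finset.mem_univ _)
  rw [Finset.sum_eq_sum_iff_of_le (fun μ _ => quad_le _ _ (hR ν) (hR μ))] at h1
  have h2 : ∀ μ, ∃ r : ℝ, R μ = (r : ℂ) •
      Matrix.vecMulVec (fun i => R ν i j0) (star (fun i => R ν i j0)) := by
    intro μ
    refine rank_one _ (hR μ) _ i0 hv fun j => ?_
    have h0 : col (R ν) j0 ≠ 0 := by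
      intro h0
      exact hv (congrArg (fun x : EuclideanSpace ℂ (Fin n) => x i0) h0)
    obtain ⟨c, hc⟩ := quad_eq _ _ (hR ν) (hR μ) (h1 μ (Finset.mem_univ _)) j0 j h0
    exact ⟨c, fun i => congrArg (fun x : EuclideanSpace ℂ (Fin n) => x i) hc⟩
  choose r hr using h2
  refine ⟨_, ?_, r, hr⟩
  rw [Matrix.IsHermitian]
  ext i j
  simp [Matrix.vecMulVec_apply, mul_comm]

lemma alpha1_par {A : Matrix (Fin n) (Fin n) ℂ} {r : I → ℝ} (h : ∀ μ, R μ = (r μ : ℂ) • A) :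
    alpha1 R = (∑ μ, r μ ^ 2) * rtr A ^ 2 := by
  simp only [alpha1, h, rtr_smul, mul_pow, Finset.sum_mul]

lemma alpha2_par {A : Matrix (Fin n) (Fin n) ℂ} {r : I → ℝ} (h : ∀ μ, R μ = (r μ : ℂ) • A) :
    alpha2 R = (∑ μ, r μ ^ 2) * rtr (A * A) := by
  simp only [alpha2, h, smul_mul_assoc, mul_smul_comm, rtr_smul, Finset.sum_mul]
  exact Finset.sum_congr rfl fun _ _ => by ring

lemma beta1_par {A : Matrix (Fin n) (Fin n) ℂ} {r : I → ℝ} (h : ∀ μ, R μ = (r μ : ℂ) • A) :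
    beta1 R = alpha2 R ^ 2 := by
  rw [alpha2_sq]
  simp only [beta1, h, smul_mul_assoc, mul_smul_comm, rtr_smul]
  exact Finset.sum_congr rfl fun _ _ => Finset.sum_congr rfl fun _ _ => by ring

lemma beta3_le (hR : ∀ μ, (R μ).IsHermitian) {M : ℝ} (h1 : beta2 R ≤ M ^ 2)
    (h2 : beta4 R ≤ M ^ 2) : |beta3 R| ≤ M ^ 2 := by
  apply abs_le_of_sq_le_sq _ (sq_nonneg M)
  exact (beta3_sq_le hR).trans
    ((mul_le_mul h1 h2 (beta4_nonneg hR) (sq_nonneg M)).trans_eq (by ring))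

lemma maxAlpha_of_le (hR : ∀ μ, (R μ).IsHermitian) (h : alpha1 R ≤ alpha2 R) :
    maxAlpha R = alpha2 R ^ 2 := by
  have h1 := alpha1_nonneg (R := R)
  have h2 := alpha2_nonneg hR
  rw [maxAlpha, abs_of_nonneg (by positivity), abs_of_nonneg (by positivity),
    abs_of_nonneg (by positivity), abs_of_nonneg (by positivity)]
  apply le_antisymm
  · refine max_le (max_le ?_ ?_) (max_le ?_ ?_) <;> nlinarith
  · rw [sq]; exact (le_max_right _ _).trans (le_max_right _ _)

lemma alpha1_le_of_eq (hR : ∀ μ, (R μ).IsHermitian) (he : maxBeta R = maxAlpha R) :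
    alpha1 R ≤ alpha2 R := by
  by_contra hc
  push Not at hc
  have h2 := alpha2_nonneg hR
  have hM : alpha1 R * alpha1 R ≤ maxAlpha R := by
    rw [maxAlpha]
    exact (le_abs_self _).trans ((le_max_left _ _).trans (le_max_left _ _))
  have hb1 := beta1_le hR
  have hb2 := beta2_le hR
  have hb4 := beta4_le hR
  have hb5 := beta5_le hR
  have hlt1 : alpha1 R * alpha2 R < alpha1 R * alpha1 R := by nlinarith
  have hlt2 : alpha2 R ^ 2 < alpha1 R * alpha1 R := by nlinarith
  have hb3 : |beta3 R| < alpha1 R * alpha1 R := by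
    apply abs_lt_of_sq_lt_sq _ (mul_self_nonneg _)
    have := beta3_sq_le hR
    have h4 := beta4_nonneg hR
    have h22 := beta2_nonneg hR
    nlinarith
  have : maxBeta R < alpha1 R * alpha1 R := by
    rw [maxBeta, abs_of_nonneg beta1_nonneg, abs_of_nonneg (beta2_nonneg hR),
      abs_of_nonneg (beta4_nonneg hR)]
    refine max_lt ?_ (max_lt ?_ (max_lt hb3 (max_lt ?_ ?_))) <;> linarith
  linarith

lemma par_of_eq (hR : ∀ μ, (R μ).IsHermitian) (h : 0 < alpha2 R) (h12 : alpha1 R ≤ alpha2 R)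
    (he : maxBeta R = alpha2 R ^ 2) : Par R := by
  have hb1 := beta1_le hR
  have hb2 := beta2_le hR
  have hb4 := beta4_le hR
  have hb5 := beta5_le hR
  have h1 := alpha1_nonneg (R := R)
  have key : alpha2 R ^ 2 ≤ beta2 R → Par R := by
    intro hk
    have h21 : alpha1 R = alpha2 R := by
      apply le_antisymm h12
      by_contra hc
      push Not at hc
      nlinarith
    refine par_of_beta2 hR (h21 ▸ h) ?_
    rw [h21] at hb2 ⊢
    linarith
  rw [maxBeta, abs_of_nonneg beta1_nonneg, abs_of_nonneg (beta2_nonneg hR),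
      abs_of_nonneg (beta4_nonneg hR)] at he
  have hle := he.ge
  rw [le_max_iff, le_max_iff, le_max_iff, le_max_iff] at hle
  rcases hle with hle | hle | hle | hle | hle
  · exact par_of_beta1 hR h (le_antisymm hb1 hle)
  · exact key hle
  · apply key
    have h3 := beta3_sq_le hR
    have h4 : (alpha2 R ^ 2) ^ 2 ≤ beta3 R ^ 2 := by
      rw [← sq_abs (beta3 R)]
      exact pow_le_pow_left₀ (by positivity) hle 2
    have h5 := mul_le_mul_of_nonneg_left hb4 (beta2_nonneg hR)
    have h6 : 0 < alpha2 R ^ 2 := by positivity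
    by_contra hc
    push Not at hc
    nlinarith
  · exact par_of_beta4 hR h (le_antisymm hb4 hle)
  · exact par_of_beta4 hR h (le_antisymm hb4 (hle.trans hb5))

end MaxBeta

/-- For a finite family of Hermitian matrices, max_u |β_u| = max_{i,j} |α_i α_j| holds
iff there exist a Hermitian matrix A with Tr(A²) ≥ (Tr A)² and reals (r_μ) with
R_μ = r_μ • A for all μ. -/
theorem max_beta_eq_max_alpha_iff {n : ℕ} {I : Type} [Fintype I]
    (R : I → Matrix (Fin n) (Fin n) ℂ) (hR : ∀ μ, (R μ).IsHermitian) :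
    maxBeta R = maxAlpha R ↔
      ∃ A : Matrix (Fin n) (Fin n) ℂ, A.IsHermitian ∧
        (Matrix.trace (A * A)).re ≥ ((Matrix.trace A).re) ^ 2 ∧
        ∃ r : I → ℝ, ∀ μ, R μ = (r μ : ℂ) • A := by
  open MaxBeta in
  constructor
  · intro he
    have h12 := alpha1_le_of_eq hR he
    rcases (alpha2_nonneg hR).eq_or_lt with h0 | h0
    · refine ⟨0, Matrix.isHermitian_zero, by simp, fun _ => 0, fun μ => ?_⟩
      have h1 := h0.symm
      rw [alpha2, Finset.sum_eq_zero_iff_of_nonneg (fun μ _ => rtr_sq_nonneg _ (hR μ))] at h1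
      rw [eq_zero_of_rtr_sq _ (hR μ) (h1 μ (Finset.mem_univ _))]
      simp
    · rw [maxAlpha_of_le hR h12] at he
      obtain ⟨A, hA, r, hr⟩ := par_of_eq hR h0 h12 he
      refine ⟨A, hA, ?_, r, hr⟩
      rw [alpha2_par hr] at h0
      rw [alpha1_par hr, alpha2_par hr] at h12
      have hs : 0 ≤ ∑ μ, r μ ^ 2 := Finset.sum_nonneg fun _ _ => sq_nonneg _
      have hs' : 0 < ∑ μ, r μ ^ 2 := by
        rcases hs.eq_or_lt with h | h
        · rw [← h] at h0; simp at h0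
        · exact h
      exact le_of_mul_le_mul_left h12 hs'
  · rintro ⟨A, hA, hAA, r, hr⟩
    have hs : 0 ≤ ∑ μ, r μ ^ 2 := Finset.sum_nonneg fun _ _ => sq_nonneg _
    have h12 : alpha1 R ≤ alpha2 R := by
      rw [alpha1_par hr, alpha2_par hr]
      exact mul_le_mul_of_nonneg_left hAA hs
    have hb1 := beta1_par hr
    have h2 := alpha2_nonneg hR
    have hb2 : beta2 R ≤ alpha2 R ^ 2 := (beta2_le hR).trans (by nlinarith)
    have hb4 := beta4_le hR
    rw [maxAlpha_of_le hR h12, maxBeta, abs_of_nonneg beta1_nonneg,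
      abs_of_nonneg (beta2_nonneg hR), abs_of_nonneg (beta4_nonneg hR), hb1]
    exact max_eq_left (max_le hb2 (max_le (beta3_le hR hb2 hb4)
      (max_le hb4 ((beta5_le hR).trans hb4))))
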